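/- arXiv:2605.19599 — 2 statements merged into one kernel-verified Lean document; each statement's English description precedes it below -/
import Mathlib

section
/- Let N ≥ 2 be an integer, α ∈ (0,1) and M > 0. Let Ω ⊆ ℝ^N be a bounded open set contained in {x : 0 < x_N < M}. Then for every smooth function u : ℝ^N → ℝ with compact support contained in Ω, one has ∫_Ω x_N^{α−2} u(x)² dx ≤ (4/(1−α)²) ∫_Ω x_N^α (∂u/∂x_N)(x)² dx. -/
open MeasureTheory Set Filter

/-- Partial derivative of `u` in the `i`-th coordinate direction. -/
noncomputable def pd {N : ℕ} (i : Fin N) (u : (Fin N → ℝ) → ℝ) (x : Fin N → ℝ) : ℝ :=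
  fderiv ℝ u x (Pi.single i 1)

/-- A power of a coordinate times a smooth function supported where that coordinate is positive
is smooth. -/
lemma contDiff_coord_rpow_mul {N : ℕ} {n : Fin N} {k : WithTop ℕ∞} (s : ℝ)
    {g : (Fin N → ℝ) → ℝ} (hg : ContDiff ℝ k g) (hpos : tsupport g ⊆ {x | 0 < x n}) :
    ContDiff ℝ k fun x => x n ^ s * g x := by
  refine contDiff_iff_contDiffAt.2 fun x => ?_
  by_cases hx : x ∈ tsupport g
  · have hcoord : ContDiffAt ℝ k (fun y : Fin N → ℝ => y n) x :=
      (contDiff_apply ℝ ℝ n).contDiffAt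
    exact (hcoord.rpow_const_of_ne (hpos hx).ne').mul hg.contDiffAt
  · have hzero : (fun y => y n ^ s * g y) =ᶠ[nhds x] fun _ => 0 := by
      filter_upwards [notMem_tsupport_iff_eventuallyEq.1 hx] with y hy
      simp [hy]
    exact contDiffAt_const.congr_of_eventuallyEq hzero

/-- A power of a coordinate times a compactly supported continuously differentiable function
supported where that coordinate is positive is integrable. -/
lemma integrable_coord_rpow_mul {N : ℕ} {n : Fin N} (s : ℝ) {g : (Fin N → ℝ) → ℝ}
    (hg : ContDiff ℝ 1 g) (hcg : HasCompactSupport g) (hpos : tsupport g ⊆ {x | 0 < x n}) :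
    Integrable fun x => x n ^ s * g x :=
  (contDiff_coord_rpow_mul s hg hpos).continuous.integrable_of_hasCompactSupport hcg.mul_left

/-- The integral of a partial derivative of a compactly supported function vanishes. -/
lemma integral_pd_eq_zero {N : ℕ} (n : Fin N) {v : (Fin N → ℝ) → ℝ}
    (hv : ContDiff ℝ 1 v) (hcv : HasCompactSupport v) :
    Integrable (pd n v) ∧ ∫ x, pd n v x = 0 := by
  have hint : Integrable (pd n v) :=
    ((hv.continuous_fderiv one_ne_zero).clm_apply continuous_const).integrable_of_hasCompactSupport
      (hcv.fderiv_apply ℝ _)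
  refine ⟨hint, ?_⟩
  have h := integral_mul_fderiv_eq_neg_fderiv_mul_of_integrable (μ := volume) (𝕜 := ℝ)
    (f := fun _ : Fin N → ℝ => (1 : ℝ)) (g := v) (v := Pi.single n 1)
    (by simp) (by simp only [one_mul]; exact hint)
    (by simpa using hv.continuous.integrable_of_hasCompactSupport hcv)
    (fun _ _ => differentiableAt_const _) (fun x _ => hv.differentiable one_ne_zero x)
  simpa [pd] using h

/-- Derivative of `x_n ^ (α - 1) u ^ 2` in the direction of `x_n`. -/
lemma pd_coord_rpow_mul_sq {N : ℕ} (n : Fin N) (α : ℝ) {u : (Fin N → ℝ) → ℝ} {x : Fin N → ℝ}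
    (hu : DifferentiableAt ℝ u x) (hx : 0 < x n) :
    pd n (fun y => y n ^ (α - 1) * u y ^ 2) x
      = (α - 1) * (x n ^ (α - 2) * u x ^ 2) + 2 * x n ^ (α - 1) * u x * pd n u x := by
  have hcoord : HasFDerivAt (fun y : Fin N → ℝ => y n)
      (ContinuousLinearMap.proj (R := ℝ) (φ := fun _ : Fin N => ℝ) n) x := hasFDerivAt_apply n x
  have h := (hcoord.rpow_const (p := α - 1) (Or.inl hx.ne')).mul (hu.hasFDerivAt.pow 2)
  have hexp : α - 1 - 1 = α - 2 := by ring
  rw [pd, HasFDerivAt.fderiv (f := fun y => y n ^ (α - 1) * u y ^ 2) h]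
  simp [pd, hexp]
  ring

/-- The pointwise form of the Hardy inequality, obtained by completing the square. -/
lemma hardy_pointwise {N : ℕ} (n : Fin N) (α : ℝ) {u : (Fin N → ℝ) → ℝ} {x : Fin N → ℝ}
    (hu : DifferentiableAt ℝ u x) (hx : 0 < x n) :
    ((1 - α) / 2) ^ 2 * (x n ^ (α - 2) * u x ^ 2)
        + (1 - α) / 2 * pd n (fun y => y n ^ (α - 1) * u y ^ 2) x
      ≤ x n ^ α * pd n u x ^ 2 := by
  rw [pd_coord_rpow_mul_sq n α hu hx]
  have h1 : x n ^ (α - 1) = x n ^ (α - 2) * x n := by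
    rw [← Real.rpow_add_one hx.ne']; ring_nf
  have h0 : x n ^ α = x n ^ (α - 2) * x n ^ 2 := by
    rw [← Real.rpow_add_natCast hx.ne']; norm_num
  rw [h1, h0]
  have hsq := mul_nonneg (Real.rpow_nonneg hx.le (α - 2))
    (sq_nonneg (x n * pd n u x - (1 - α) / 2 * u x))
  linarith

/-- The weighted Hardy inequality (Lemma 2.2) with explicit constant `4/(1-α)²`. -/
theorem hardy_inequality (N : ℕ) (hN : 2 ≤ N) (n : Fin N) (hn : (n : ℕ) = N - 1)
    (α M : ℝ) (hα : α ∈ Ioo (0 : ℝ) 1) (hM : 0 < M)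
    (Ω : Set (Fin N → ℝ)) (hΩo : IsOpen Ω) (hΩb : Bornology.IsBounded Ω)
    (hΩs : Ω ⊆ {x | 0 < x n ∧ x n < M})
    (u : (Fin N → ℝ) → ℝ) (hu : ContDiff ℝ (⊤ : ℕ∞) u) (hcs : HasCompactSupport u)
    (hsupp : tsupport u ⊆ Ω) :
    ∫ x in Ω, x n ^ (α - 2) * (u x) ^ 2
      ≤ (4 / (1 - α) ^ 2) * ∫ x in Ω, x n ^ α * (pd n u x) ^ 2 := by
  have hu1 : ContDiff ℝ 1 u := hu.of_le (by exact_mod_cast le_top)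
  have hdu : ContDiff ℝ 1 (pd n u) :=
    (hu.fderiv_right (m := 1) (WithTop.coe_le_coe.2 le_top)).clm_apply contDiff_const
  have hsq {f : (Fin N → ℝ) → ℝ} : tsupport (fun x => f x ^ 2) ⊆ tsupport f :=
    closure_mono fun x hx h => hx (by simp [h])
  have hdsupp : tsupport (pd n u) ⊆ tsupport u := tsupport_fderiv_apply_subset ℝ _
  have hpos : tsupport u ⊆ {x | 0 < x n} := fun x hx => (hΩs (hsupp hx)).1
  have hcu2 : HasCompactSupport fun x => u x ^ 2 := hcs.of_isClosed_subset isClosed_closure hsq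
  have hcdu2 : HasCompactSupport fun x => pd n u x ^ 2 :=
    hcs.of_isClosed_subset isClosed_closure (hsq.trans hdsupp)
  have hA := integrable_coord_rpow_mul α (hdu.pow 2) hcdu2 ((hsq.trans hdsupp).trans hpos)
  have hB := integrable_coord_rpow_mul (α - 2) (hu1.pow 2) hcu2 (hsq.trans hpos)
  obtain ⟨hDint, hD⟩ := integral_pd_eq_zero n
    (contDiff_coord_rpow_mul (α - 1) (hu1.pow 2) (hsq.trans hpos)) hcu2.mul_left
  have hu0 {x : Fin N → ℝ} (hx : x ∉ tsupport u) : u x = 0 := image_eq_zero_of_notMem_tsupport hx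
  have hdu0 {x : Fin N → ℝ} (hx : x ∉ tsupport u) : pd n u x = 0 :=
    image_eq_zero_of_notMem_tsupport fun h => hx (hdsupp h)
  rw [setIntegral_eq_integral_of_forall_compl_eq_zero fun x hx => by
      simp [hu0 fun h => hx (hsupp h)],
    setIntegral_eq_integral_of_forall_compl_eq_zero fun x hx => by
      simp [hdu0 fun h => hx (hsupp h)]]
  have hle := integral_mono ((hB.const_mul (((1 - α) / 2) ^ 2)).add (hDint.const_mul ((1 - α) / 2)))
    hA fun x => by
      by_cases hx : x ∈ tsupport u
      · exact hardy_pointwise n α (hu1.differentiable one_ne_zero x) (hpos hx)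
      · have hv : pd n (fun y => y n ^ (α - 1) * u y ^ 2) x = 0 := by
          have hzero : (fun y => y n ^ (α - 1) * u y ^ 2) =ᶠ[nhds x] fun _ => 0 := by
            filter_upwards [notMem_tsupport_iff_eventuallyEq.1 hx] with y hy
            simp [hy]
          simp [pd, hzero.fderiv_eq]
        simp [hv, hu0 hx, hdu0 hx]
  rw [integral_add' (hB.const_mul _) (hDint.const_mul _), integral_const_mul, integral_const_mul,
    hD, mul_zero, add_zero] at hle
  have hc : 0 < 1 - α := sub_pos.2 hα.2
  rw [div_mul_eq_mul_div, le_div_iff₀ (by positivity)]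
  linarith
end

section
/- Let N ≥ 2, α ∈ (0,1), T > 0, γ ∈ ℝ, s > 0. Set Θ(t) = (t(T−t))^{−4} for t ∈ (0,T), ξ(x,t) = Θ(t)(γ − x_N^{2−α}), A(x) = diag(1,…,1,x_N^α). Let Ω ⊆ {x ∈ ℝ^N : x_N > 0} be a bounded open set, and let z be a smooth function on ℝ^N × ℝ with compact support contained in Ω × (0,T). Then ∫₀^T ∫_Ω (2s A∇z·∇ξ + s z div(A∇ξ)) · div(A∇z) dx dt = (2−α)² s ∫₀^T ∫_Ω Θ(t) x_N^α (∂z/∂x_N)² dx dt. -/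
open MeasureTheory Set Filter

/-- The temporal Carleman weight `Θ(t) = (t(T-t))⁻⁴`. -/
noncomputable def Theta (T : ℝ) : ℝ → ℝ := fun t => (t * (T - t)) ^ (-4 : ℤ)

/-- The Carleman weight `ξ(x,t) = Θ(t)(γ - x_N^{2-α})`, with `n` the last coordinate index. -/
noncomputable def xi {N : ℕ} (n : Fin N) (α T γ : ℝ) (y : Fin N → ℝ) (τ : ℝ) : ℝ :=
  Theta T τ * (γ - y n ^ (2 - α))

/-- `A∇f·∇g = Σ_{i≠n} ∂_i f ∂_i g + x_N^α ∂_N f ∂_N g` for `A = diag(1,…,1,x_N^α)`. -/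
noncomputable def agrad {N : ℕ} (α : ℝ) (n : Fin N) (f g : (Fin N → ℝ) → ℝ)
    (x : Fin N → ℝ) : ℝ :=
  (∑ i ∈ Finset.univ.erase n, pd i f x * pd i g x) + x n ^ α * pd n f x * pd n g x

/-- `div(A∇f) = Σ_{i≠n} ∂²f/∂x_i² + ∂/∂x_N (x_N^α ∂f/∂x_N)` for `A = diag(1,…,1,x_N^α)`. -/
noncomputable def divA {N : ℕ} (α : ℝ) (n : Fin N) (f : (Fin N → ℝ) → ℝ)
    (x : Fin N → ℝ) : ℝ :=
  (∑ i ∈ Finset.univ.erase n, pd i (fun y => pd i f y) x) +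
    pd n (fun y => y n ^ α * pd n f y) x

section PartialDerivative

variable {N : ℕ} {i j n : Fin N} {f g : (Fin N → ℝ) → ℝ} {x : Fin N → ℝ}

theorem pd_add (hf : DifferentiableAt ℝ f x) (hg : DifferentiableAt ℝ g x) :
    pd i (fun y => f y + g y) x = pd i f x + pd i g x := by
  simp [pd, fderiv_fun_add hf hg]

theorem pd_mul (hf : DifferentiableAt ℝ f x) (hg : DifferentiableAt ℝ g x) :
    pd i (fun y => f y * g y) x = f x * pd i g x + g x * pd i f x := by
  simp [pd, fderiv_fun_mul hf hg]

theorem pd_congr (h : f =ᶠ[nhds x] g) : pd i f x = pd i g x := by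
  simp [pd, h.fderiv_eq]

theorem pd_comp_apply {φ : ℝ → ℝ} {φ' : ℝ} (h : HasDerivAt φ φ' (x n)) :
    pd i (fun y => φ (y n)) x = φ' * (Pi.single i 1 : Fin N → ℝ) n := by
  have h1 : HasFDerivAt (fun y : Fin N → ℝ => y n)
      (ContinuousLinearMap.proj (R := ℝ) (φ := fun _ : Fin N => ℝ) n) x :=
    (ContinuousLinearMap.proj (R := ℝ) (φ := fun _ : Fin N => ℝ) n).hasFDerivAt
  have h2 := h.comp_hasFDerivAt x h1
  have h3 : fderiv ℝ (fun y : Fin N → ℝ => φ (y n)) x = _ := h2.fderiv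
  simp [pd, h3]

theorem pd_apply_self : pd n (fun y => y n) x = 1 := by
  simpa using pd_comp_apply (i := n) (hasDerivAt_id (x n))

theorem pd_apply_of_ne (h : i ≠ n) : pd i (fun y => y n) x = 0 := by
  simpa [Pi.single_apply, h.symm] using pd_comp_apply (i := i) (hasDerivAt_id (x n))

theorem contDiff_pd (hf : ContDiff ℝ (⊤ : ℕ∞) f) : ContDiff ℝ (⊤ : ℕ∞) (pd i f) := by
  have h : ContDiff ℝ (⊤ : ℕ∞) (fderiv ℝ f) := hf.fderiv_right (by simp)
  exact h.clm_apply contDiff_const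

theorem pd_comm (hf : ContDiff ℝ (⊤ : ℕ∞) f) : pd i (pd j f) x = pd j (pd i f) x := by
  have h2 : ContDiff ℝ 2 f := contDiff_infty.1 hf 2
  have h : DifferentiableAt ℝ (fderiv ℝ f) x :=
    ((h2.fderiv_right (m := 1) (by norm_num)).differentiable one_ne_zero) x
  have key (k l : Fin N) : pd k (pd l f) x =
      fderiv ℝ (fderiv ℝ f) x (Pi.single k 1) (Pi.single l 1) := by
    have h' := (h.hasFDerivAt.clm_apply
      (hasFDerivAt_const (Pi.single l 1 : Fin N → ℝ) x)).fderiv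
    have e : pd k (pd l f) x =
      fderiv ℝ (fun y => fderiv ℝ f y (Pi.single l 1)) x (Pi.single k 1) := rfl
    rw [e, h']
    simp
  rw [key, key]
  exact h2.contDiffAt.isSymmSndFDerivAt (by simp) _ _

theorem pd_eq_zero_of_notMem_tsupport (hx : x ∉ tsupport f) : pd i f x = 0 := by
  have h : fderiv ℝ f x = 0 := by
    by_contra h
    exact hx (support_fderiv_subset ℝ h)
  simp [pd, h]

theorem integral_pd_eq_zero_s10 (hf : ContDiff ℝ 1 f) (hc : HasCompactSupport f) :
    ∫ x, pd i f x = 0 := by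
  have h := integral_mul_fderiv_eq_neg_fderiv_mul_of_integrable (𝕜 := ℝ)
    (μ := (volume : Measure (Fin N → ℝ))) (f := fun _ => (1 : ℝ)) (g := f)
    (v := Pi.single i 1) (by simp) ?_ ?_ (by fun_prop)
    (fun y _ => hf.differentiable one_ne_zero y)
  · simpa [pd] using h
  · simpa using ((hf.continuous_fderiv one_ne_zero).clm_apply
      continuous_const).integrable_of_hasCompactSupport (hc.fderiv_apply ℝ _)
  · simpa using hf.continuous.integrable_of_hasCompactSupport hc

theorem integrable_pd (hf : ContDiff ℝ 1 f) (hc : HasCompactSupport f) :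
    Integrable (pd i f) :=
  ((hf.continuous_fderiv one_ne_zero).clm_apply
    continuous_const).integrable_of_hasCompactSupport (hc.fderiv_apply ℝ _)

theorem setIntegral_pd_eq_zero {Ω : Set (Fin N → ℝ)} (hf : ContDiff ℝ 1 f)
    (hc : HasCompactSupport f) (hΩ : tsupport f ⊆ Ω) : ∫ x in Ω, pd i f x = 0 := by
  rw [setIntegral_eq_integral_of_forall_compl_eq_zero, integral_pd_eq_zero_s10 hf hc]
  exact fun x hx => pd_eq_zero_of_notMem_tsupport fun h => hx (hΩ h)

end PartialDerivative

section Weight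

variable {N : ℕ} {n : Fin N} {α T γ t : ℝ} {x : Fin N → ℝ}

theorem pd_rpow (i : Fin N) (β : ℝ) (hx : 0 < x n) :
    pd i (fun y => y n ^ β) x = β * x n ^ (β - 1) * (Pi.single i 1 : Fin N → ℝ) n :=
  pd_comp_apply (Real.hasDerivAt_rpow_const (Or.inl hx.ne'))

theorem pd_xi (i : Fin N) (hx : 0 < x n) :
    pd i (fun y => xi n α T γ y t) x =
      -(Theta T t * (2 - α) * x n ^ (1 - α)) * (Pi.single i 1 : Fin N → ℝ) n := by
  have h : HasDerivAt (fun r : ℝ => Theta T t * (γ - r ^ (2 - α)))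
      (Theta T t * -((2 - α) * x n ^ (2 - α - 1))) (x n) :=
    ((Real.hasDerivAt_rpow_const (Or.inl hx.ne')).const_sub γ).const_mul _
  have h' := pd_comp_apply (i := i) h
  rw [show (2 - α - 1) = 1 - α by ring] at h'
  simp only [xi]
  rw [h']
  ring

theorem eventually_pos_apply (hx : 0 < x n) : ∀ᶠ y in nhds x, 0 < y n :=
  (isOpen_lt continuous_const (continuous_apply n)).mem_nhds hx

theorem agrad_xi (f : (Fin N → ℝ) → ℝ) (hx : 0 < x n) :
    agrad α n f (fun y => xi n α T γ y t) x =
      -(Theta T t * (2 - α)) * (x n * pd n f x) := by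
  have h0 : ∑ i ∈ Finset.univ.erase n, pd i f x * pd i (fun y => xi n α T γ y t) x = 0 := by
    refine Finset.sum_eq_zero fun i hi => ?_
    simp [pd_xi i hx, (Finset.ne_of_mem_erase hi).symm]
  have h1 : x n ^ α * x n ^ (1 - α) = x n := by
    rw [← Real.rpow_add hx]; simp
  rw [agrad, h0, pd_xi n hx, Pi.single_eq_same]
  linear_combination -(Theta T t * (2 - α) * pd n f x) * h1

theorem divA_xi (hx : 0 < x n) :
    divA α n (fun y => xi n α T γ y t) x = -(Theta T t * (2 - α)) := by
  have h0 : ∑ i ∈ Finset.univ.erase n,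
      pd i (fun y => pd i (fun y => xi n α T γ y t) y) x = 0 := by
    refine Finset.sum_eq_zero fun i hi => ?_
    have : (fun y => pd i (fun y => xi n α T γ y t) y) =ᶠ[nhds x] fun _ => 0 := by
      filter_upwards [eventually_pos_apply hx] with y hy
      simp [pd_xi i hy, (Finset.ne_of_mem_erase hi).symm]
    rw [pd_congr this]
    simp [pd]
  have h1 : (fun y : Fin N → ℝ => y n ^ α * pd n (fun y => xi n α T γ y t) y) =ᶠ[nhds x]
      fun y => -(Theta T t * (2 - α)) * y n := by
    filter_upwards [eventually_pos_apply hx] with y hy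
    have h1 : y n ^ α * y n ^ (1 - α) = y n := by
      rw [← Real.rpow_add hy]; simp
    rw [pd_xi n hy, Pi.single_eq_same]
    linear_combination -(Theta T t * (2 - α)) * h1
  have h2 := pd_comp_apply (i := n) ((hasDerivAt_id (x n)).const_mul (-(Theta T t * (2 - α))))
  simp only [id, Pi.single_eq_same, mul_one] at h2
  rw [divA, h0, pd_congr h1, h2, zero_add]

/-- The flux `x_N^α ∂_N u` is smooth when `u` is supported away from `x_N ≤ 0`. -/
theorem contDiff_rpow_mul_pd {u : (Fin N → ℝ) → ℝ} (hu : ContDiff ℝ (⊤ : ℕ∞) u)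
    (hpos : ∀ x ∈ tsupport u, 0 < x n) :
    ContDiff ℝ (⊤ : ℕ∞) (fun y => y n ^ α * pd n u y) := by
  rw [contDiff_iff_contDiffAt]
  intro x
  by_cases hx : x ∈ tsupport u
  · exact ((contDiff_apply ℝ ℝ n).contDiffAt.rpow_const_of_ne (hpos x hx).ne').mul
      (contDiff_pd hu).contDiffAt
  · refine (contDiffAt_const (c := (0 : ℝ))).congr_of_eventuallyEq ?_
    filter_upwards [(isClosed_tsupport u).isOpen_compl.mem_nhds hx] with y hy
    simp [pd_eq_zero_of_notMem_tsupport hy]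

/-- The multiplier identity: `(2 x_N ∂_N u + u) div(A∇u)` is a divergence up to
`-(2 - α) x_N^α (∂_N u)²`. -/
theorem multiplier_mul_divA {u : (Fin N → ℝ) → ℝ} (hu : ContDiff ℝ (⊤ : ℕ∞) u)
    (hx : 0 < x n) :
    (2 * (x n * pd n u x) + u x) * divA α n u x =
      (∑ i ∈ Finset.univ.erase n,
        (pd i (fun y => (2 * (y n * pd n u y) + u y) * pd i u y) x
          + pd n (fun y => -y n * (pd i u y * pd i u y)) x))
      + pd n (fun y => (y n ^ α * pd n u y) * (u y + y n * pd n u y)) x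
      + -(2 - α) * (x n ^ α * pd n u x ^ 2) := by
  have du : DifferentiableAt ℝ u x := hu.differentiable (by simp) x
  have dp (i : Fin N) : DifferentiableAt ℝ (pd i u) x :=
    (contDiff_pd hu).differentiable (by simp) x
  have dn : DifferentiableAt ℝ (fun y : Fin N → ℝ => y n) x := by fun_prop
  have dr : DifferentiableAt ℝ (fun y : Fin N → ℝ => y n ^ α) x :=
    dn.rpow_const (Or.inl hx.ne')
  have dw : DifferentiableAt ℝ (fun y => y n ^ α * pd n u y) x := dr.mul (dp n)
  have hr : x n ^ (α - 1) * x n = x n ^ α := by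
    rw [← Real.rpow_add_one hx.ne']; simp
  have d2 (i : Fin N) : pd i (fun y => 2 * (y n * pd n u y)) x
      = 2 * pd i (fun y => y n * pd n u y) x := by
    rw [pd_mul (by fun_prop) (by fun_prop)]
    simp [pd]
  have dneg : pd n (fun y => -y n) x = -1 := by
    simpa using pd_comp_apply (i := n) (hasDerivAt_id (x n)).neg
  have hi : ∀ i ∈ Finset.univ.erase n,
      pd i (fun y => (2 * (y n * pd n u y) + u y) * pd i u y) x
        + pd n (fun y => -y n * (pd i u y * pd i u y)) x
      = (2 * (x n * pd n u x) + u x) * pd i (fun y => pd i u y) x := by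
    intro i hi
    have hne := Finset.ne_of_mem_erase hi
    rw [pd_mul (by fun_prop) (by fun_prop), pd_add (by fun_prop) (by fun_prop), d2,
      pd_mul dn (dp n), pd_mul (by fun_prop) (by fun_prop), pd_mul (dp i) (dp i),
      pd_apply_of_ne hne, dneg, pd_comm (i := n) (j := i) hu]
    ring
  rw [Finset.sum_congr rfl hi, ← Finset.mul_sum, divA, pd_mul dw (by fun_prop),
    pd_add (by fun_prop) (by fun_prop), pd_mul dn (dp n), pd_mul dr (dp n), pd_apply_self,
    pd_rpow n α hx, Pi.single_eq_same]
  linear_combination (α * pd n u x ^ 2) * hr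

theorem setIntegral_multiplier_mul_divA {Ω : Set (Fin N → ℝ)} {u : (Fin N → ℝ) → ℝ}
    (hΩm : MeasurableSet Ω) (hΩs : Ω ⊆ {x | 0 < x n}) (hu : ContDiff ℝ (⊤ : ℕ∞) u)
    (hc : HasCompactSupport u) (hsupp : tsupport u ⊆ Ω) :
    ∫ x in Ω, (2 * (x n * pd n u x) + u x) * divA α n u x =
      -(2 - α) * ∫ x in Ω, x n ^ α * pd n u x ^ 2 := by
  have hW := contDiff_rpow_mul_pd (α := α) hu fun x hx => hΩs (hsupp hx)
  have hP (i : Fin N) := contDiff_pd (i := i) hu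
  have h1 {f : (Fin N → ℝ) → ℝ} (hf : ContDiff ℝ (⊤ : ℕ∞) f) : ContDiff ℝ 1 f :=
    hf.of_le (by exact_mod_cast le_top)
  have hts {f : (Fin N → ℝ) → ℝ} (hf : ∀ x ∉ tsupport u, f x = 0) :
      tsupport f ⊆ tsupport u :=
    closure_minimal (fun x hx => by_contra fun h => hx (hf x h)) (isClosed_tsupport u)
  have hcs {f : (Fin N → ℝ) → ℝ} (hf : ∀ x ∉ tsupport u, f x = 0) : HasCompactSupport f :=
    hc.of_isClosed_subset (isClosed_tsupport f) (hts hf)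
  have hn : ContDiff ℝ (⊤ : ℕ∞) (fun y : Fin N → ℝ => y n) := contDiff_apply ℝ ℝ n
  have sF (i : Fin N) : ContDiff ℝ 1 (fun y => (2 * (y n * pd n u y) + u y) * pd i u y) :=
    h1 (((contDiff_const.mul (hn.mul (hP n))).add hu).mul (hP i))
  have sG (i : Fin N) : ContDiff ℝ 1 (fun y => -y n * (pd i u y * pd i u y)) :=
    h1 (hn.neg.mul ((hP i).mul (hP i)))
  have sH : ContDiff ℝ 1 (fun y => (y n ^ α * pd n u y) * (u y + y n * pd n u y)) :=
    h1 (hW.mul (hu.add (hn.mul (hP n))))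
  have zF (i : Fin N) : ∀ x ∉ tsupport u, (2 * (x n * pd n u x) + u x) * pd i u x = 0 :=
    fun x hx => by simp [pd_eq_zero_of_notMem_tsupport hx]
  have zG (i : Fin N) : ∀ x ∉ tsupport u, -x n * (pd i u x * pd i u x) = 0 :=
    fun x hx => by simp [pd_eq_zero_of_notMem_tsupport hx]
  have zH : ∀ x ∉ tsupport u, (x n ^ α * pd n u x) * (u x + x n * pd n u x) = 0 :=
    fun x hx => by simp [pd_eq_zero_of_notMem_tsupport hx]
  have iQ : Integrable (fun x => x n ^ α * pd n u x ^ 2) := by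
    have : Continuous (fun x => (x n ^ α * pd n u x) * pd n u x) :=
      hW.continuous.mul (hP n).continuous
    simp only [mul_assoc, ← sq] at this
    exact this.integrable_of_hasCompactSupport
      (hcs fun x hx => by simp [pd_eq_zero_of_notMem_tsupport hx])
  have iF (i : Fin N) := (integrable_pd (i := i) (sF i) (hcs (zF i))).integrableOn (s := Ω)
  have iG (i : Fin N) := (integrable_pd (i := n) (sG i) (hcs (zG i))).integrableOn (s := Ω)
  have iH := (integrable_pd (i := n) sH (hcs zH)).integrableOn (s := Ω)
  have iFG (i : Fin N) : IntegrableOn (fun x =>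
      pd i (fun y => (2 * (y n * pd n u y) + u y) * pd i u y) x
        + pd n (fun y => -y n * (pd i u y * pd i u y)) x) Ω := (iF i).add (iG i)
  have iS := integrable_finsetSum (Finset.univ.erase n) fun i _ => iFG i
  rw [setIntegral_congr_fun hΩm fun x hx => multiplier_mul_divA hu (hΩs hx),
    integral_add (by exact iS.add iH) (iQ.integrableOn.const_mul _), integral_add iS iH,
    integral_finsetSum _ fun i _ => iFG i, integral_const_mul,
    setIntegral_pd_eq_zero sH (hcs zH) ((hts zH).trans hsupp), Finset.sum_eq_zero]
  · ring
  · intro i _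
    rw [integral_add (iF i) (iG i),
      setIntegral_pd_eq_zero (sF i) (hcs (zF i)) ((hts (zF i)).trans hsupp),
      setIntegral_pd_eq_zero (sG i) (hcs (zG i)) ((hts (zG i)).trans hsupp), add_zero]

end Weight

theorem tsupport_slice_subset {X Y : Type*} [TopologicalSpace X] [TopologicalSpace Y]
    (z : X → Y → ℝ) (t : Y) :
    tsupport (fun x => z x t) ⊆
      (fun x => (x, t)) ⁻¹' tsupport (fun p : X × Y => z p.1 p.2) :=
  closure_minimal (fun _ hx => subset_tsupport (fun p : X × Y => z p.1 p.2) hx)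
    ((isClosed_tsupport _).preimage (by fun_prop))

/-- Step b) of the Carleman computation: the pairing `(P₁₂z + P₁₃z, P₂₁z)`
(compact-support case, no boundary term). -/
theorem carleman_step_b
    (N : ℕ) (hN : 2 ≤ N) (n : Fin N) (hn : (n : ℕ) = N - 1)
    (α T γ s : ℝ) (hα : α ∈ Ioo (0 : ℝ) 1) (hT : 0 < T) (hs : 0 < s)
    (Ω : Set (Fin N → ℝ)) (hΩo : IsOpen Ω) (hΩb : Bornology.IsBounded Ω)
    (hΩs : Ω ⊆ {x | 0 < x n})
    (z : (Fin N → ℝ) → ℝ → ℝ)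
    (hz : ContDiff ℝ (⊤ : ℕ∞) (fun p : (Fin N → ℝ) × ℝ => z p.1 p.2))
    (hcs : HasCompactSupport (fun p : (Fin N → ℝ) × ℝ => z p.1 p.2))
    (hsupp : tsupport (fun p : (Fin N → ℝ) × ℝ => z p.1 p.2) ⊆ Ω ×ˢ Ioo (0 : ℝ) T) :
    ∫ t in Ioo (0 : ℝ) T, ∫ x in Ω,
        (2 * s * agrad α n (fun x' => z x' t) (fun x' => xi n α T γ x' t) x
            + s * z x t * divA α n (fun x' => xi n α T γ x' t) x)
          * divA α n (fun x' => z x' t) x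
      = (2 - α) ^ 2 * s * (∫ t in Ioo (0 : ℝ) T, ∫ x in Ω,
          Theta T t * x n ^ α * (pd n (fun x' => z x' t) x) ^ 2) := by
  rw [← integral_const_mul]
  refine setIntegral_congr_fun measurableSet_Ioo fun t _ => ?_
  have hu : ContDiff ℝ (⊤ : ℕ∞) (fun x => z x t) := hz.comp (contDiff_prodMk_left t)
  have hsl := tsupport_slice_subset z t
  have hc : HasCompactSupport (fun x => z x t) :=
    (hcs.isCompact.image continuous_fst).of_isClosed_subset (isClosed_tsupport _)
      fun x hx => ⟨(x, t), hsl hx, rfl⟩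
  have hmain := setIntegral_multiplier_mul_divA (α := α) hΩo.measurableSet hΩs hu hc
    fun x hx => (hsupp (hsl hx)).1
  have hL : EqOn (fun x => (2 * s * agrad α n (fun x' => z x' t) (fun x' => xi n α T γ x' t) x
            + s * z x t * divA α n (fun x' => xi n α T γ x' t) x)
          * divA α n (fun x' => z x' t) x)
      (fun x => -(s * Theta T t * (2 - α)) *
        ((2 * (x n * pd n (fun x' => z x' t) x) + z x t) * divA α n (fun x' => z x' t) x)) Ω := by
    intro x hx
    simp only [agrad_xi _ (hΩs hx), divA_xi (hΩs hx)]
    ring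
  simp only [mul_assoc (Theta T t)]
  rw [setIntegral_congr_fun hΩo.measurableSet hL, integral_const_mul, hmain, integral_const_mul]
  ring
end
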